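/- Fix k ≥ 1 and 0 < ε < 1, let ω : ℕ → ℝ be any function tending to infinity, and let p : ℕ → [0,1] satisfy p(n) ≥ (2(k+1)(k+2)·log n + ω(n))/(ε² n) for all n. Then asymptotically almost surely a random complex Y ∈ Y_k(n, p(n)) satisfies h^k(Y) ≥ (1−ε)·p(n)·n/(k+2); that is, the probability that every k-cochain β on Δ_n that is not a coboundary satisfies ‖dβ‖_Y ≥ (1−ε)·p(n)·(n/(k+2))·‖[β]‖ tends to 1 as n → ∞. -/

import Mathlib

open scoped Classical

/-- The faces of the complete simplicial complex on vertex set `Fin n`,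
indexed by cardinality: an element of `SFace n m` is an `m`-element subset
of `{1, …, n}` (so a `(m-1)`-dimensional face). -/
abbrev SFace (n m : ℕ) : Type := {σ : Finset (Fin n) // σ.card = m}

/-- The norm of a `ZMod 2`-cochain: the size of its support. -/
def cnorm {X : Type} [Fintype X] (β : X → ZMod 2) : ℕ :=
  (Finset.univ.filter fun x => β x ≠ 0).card

/-- The simplicial coboundary map on the complete complex: for a cochain `β`
on `m`-element subsets, `sd β` evaluated on an `(m+1)`-element subset `τ` is
the sum of `β σ` over all `m`-element subsets `σ ⊆ τ`. -/
def sd {n m : ℕ} (β : SFace n m → ZMod 2) : SFace n (m + 1) → ZMod 2 :=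
  fun τ => ∑ σ : SFace n m, if σ.1 ⊆ τ.1 then β σ else 0

/-- A `k`-cochain is a coboundary if it is `dα` for some `(k-1)`-cochain `α`. -/
def IsCob {n k : ℕ} (β : SFace n (k + 1) → ZMod 2) : Prop :=
  ∃ α : SFace n k → ZMod 2, sd α = β

/-- The quotient norm `‖[β]‖ = min_α ‖β + dα‖` of a `k`-cochain. -/
noncomputable def qnorm {n k : ℕ} (β : SFace n (k + 1) → ZMod 2) : ℕ :=
  sInf {m | ∃ α : SFace n k → ZMod 2, m = cnorm (β + sd α)}

/-- Extension of a cochain by zero to all finite sets of vertices. -/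
def extendZero {n m : ℕ} (β : SFace n m → ZMod 2) (s : Finset (Fin n)) : ZMod 2 :=
  if h : s.card = m then β ⟨s, h⟩ else 0

lemma extendZero_coe {n m : ℕ} (β : SFace n m → ZMod 2) (σ : SFace n m) :
    extendZero β σ.1 = β σ := by
  simp [extendZero, σ.2]

lemma sd_eq_sum_erase {n m : ℕ} (β : SFace n m → ZMod 2) (τ : SFace n (m + 1)) :
    sd β τ = ∑ x ∈ τ.1, extendZero β (τ.1.erase x) := by
  unfold sd
  rw [← Finset.sum_filter]
  symm
  have hc : ∀ x ∈ τ.1, (τ.1.erase x).card = m := fun x hx => by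
    rw [Finset.card_erase_of_mem hx, τ.2]; rfl
  refine Finset.sum_bij (fun x hx => ⟨τ.1.erase x, hc x hx⟩) ?_ ?_ ?_ ?_
  · intro x hx
    simp [Finset.erase_subset]
  · intro x hx y hy hxy
    exact Finset.erase_injOn τ.1 hx hy (congrArg Subtype.val hxy)
  · intro σ hσ
    have hsub : σ.1 ⊆ τ.1 := (Finset.mem_filter.1 hσ).2
    obtain ⟨x, hx⟩ := Finset.card_eq_one.1
      (show (τ.1 \ σ.1).card = 1 by rw [Finset.card_sdiff_of_subset hsub, τ.2, σ.2]; omega)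
    have hxm : x ∈ τ.1 \ σ.1 := by simp [hx]
    refine ⟨x, (Finset.mem_sdiff.1 hxm).1, Subtype.ext ?_⟩
    change τ.1.erase x = σ.1
    rw [Finset.erase_eq, ← hx, Finset.sdiff_sdiff_eq_self hsub]
  · intro x hx
    exact extendZero_coe β ⟨τ.1.erase x, hc x hx⟩

lemma extendZero_sd {n m : ℕ} (β : SFace n m → ZMod 2) {s : Finset (Fin n)}
    (hs : s.card = m + 1) :
    extendZero (sd β) s = ∑ x ∈ s, extendZero β (s.erase x) := by
  rw [← sd_eq_sum_erase β ⟨s, hs⟩]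
  exact extendZero_coe (sd β) ⟨s, hs⟩

lemma sd_add {n m : ℕ} (β γ : SFace n m → ZMod 2) : sd (β + γ) = sd β + sd γ := by
  funext τ
  simp only [sd, Pi.add_apply, ← Finset.sum_filter, Finset.sum_add_distrib]

lemma sd_sd {n m : ℕ} (α : SFace n m → ZMod 2) : sd (sd α) = 0 := by
  funext τ
  have h : ∀ x ∈ τ.1, extendZero (sd α) (τ.1.erase x) =
      ∑ y ∈ τ.1.erase x, extendZero α ((τ.1.erase x).erase y) := fun x hx =>
    extendZero_sd α (by rw [Finset.card_erase_of_mem hx, τ.2]; rfl)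
  rw [sd_eq_sum_erase, Finset.sum_congr rfl h, Finset.sum_sigma']
  refine Finset.sum_involution (fun a _ => ⟨a.2, a.1⟩) ?_ ?_ ?_ ?_
  · rintro ⟨x, y⟩ _
    rw [Finset.erase_right_comm]
    exact CharTwo.add_self_eq_zero _
  · rintro ⟨x, y⟩ ha _ heq
    simp only [Finset.mem_sigma, Finset.mem_erase] at ha
    simp only [Sigma.mk.injEq] at heq
    exact ha.2.1 heq.1
  · rintro ⟨x, y⟩ ha
    simp only [Finset.mem_sigma, Finset.mem_erase] at ha ⊢
    exact ⟨ha.2.2, ha.2.1.symm, ha.1⟩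
  · rintro ⟨x, y⟩ _
    rfl

/-- The contraction of a cochain at a vertex `v`. -/
def contractAt {n k : ℕ} (v : Fin n) (β : SFace n (k + 1) → ZMod 2) : SFace n k → ZMod 2 :=
  fun ρ => extendZero β (insert v ρ.1)

lemma extendZero_contractAt {n k : ℕ} (v : Fin n) (β : SFace n (k + 1) → ZMod 2)
    {s : Finset (Fin n)} (hs : s.card = k) :
    extendZero (contractAt v β) s = extendZero β (insert v s) := by
  simp [extendZero, contractAt, hs]

lemma add_sd_contractAt_of_mem {n k : ℕ} {v : Fin n} (β : SFace n (k + 1) → ZMod 2)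
    {σ : SFace n (k + 1)} (hv : v ∈ σ.1) : (β + sd (contractAt v β)) σ = 0 := by
  have hc : ∀ x ∈ σ.1, (σ.1.erase x).card = k := fun x hx => by
    rw [Finset.card_erase_of_mem hx, σ.2]; rfl
  have h : ∀ x ∈ σ.1, extendZero (contractAt v β) (σ.1.erase x) =
      if x = v then β σ else 0 := by
    intro x hx
    rw [extendZero_contractAt v β (hc x hx)]
    split_ifs with hxv
    · rw [hxv, Finset.insert_erase hv, extendZero_coe]
    · rw [Finset.insert_eq_of_mem (Finset.mem_erase.2 ⟨fun h => hxv h.symm, hv⟩)]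
      simp [extendZero, hc x hx]
  rw [Pi.add_apply, sd_eq_sum_erase, Finset.sum_congr rfl h, Finset.sum_ite_eq', if_pos hv]
  exact CharTwo.add_self_eq_zero _

lemma add_sd_contractAt_of_notMem {n k : ℕ} {v : Fin n} (β : SFace n (k + 1) → ZMod 2)
    {σ : SFace n (k + 1)} (hv : v ∉ σ.1) :
    (β + sd (contractAt v β)) σ = extendZero (sd β) (insert v σ.1) := by
  rw [extendZero_sd β (by rw [Finset.card_insert_of_notMem hv, σ.2]), Finset.sum_insert hv,
    Finset.erase_insert hv, extendZero_coe, Pi.add_apply, sd_eq_sum_erase]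
  congr 1
  refine Finset.sum_congr rfl fun x hx => ?_
  have hvx : v ≠ x := fun h => hv (by rwa [h])
  rw [extendZero_contractAt v β (by rw [Finset.card_erase_of_mem hx, σ.2]; rfl),
    Finset.erase_insert_of_ne hvx]

lemma cnorm_add_sd_contractAt_le {n k : ℕ} (v : Fin n) (β : SFace n (k + 1) → ZMod 2) :
    cnorm (β + sd (contractAt v β)) ≤
      (Finset.univ.filter fun τ : SFace n (k + 2) => sd β τ ≠ 0 ∧ v ∈ τ.1).card := by
  have hv : ∀ σ ∈ Finset.univ.filter (fun σ => (β + sd (contractAt v β)) σ ≠ 0), v ∉ σ.1 :=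
    fun σ hσ hmem => (Finset.mem_filter.1 hσ).2 (add_sd_contractAt_of_mem β hmem)
  unfold cnorm
  rw [← Finset.card_map (Function.Embedding.subtype _),
    ← Finset.card_map (s := Finset.filter (fun τ : SFace n (k + 2) => _) _)
      (Function.Embedding.subtype _)]
  refine Finset.card_le_card_of_injOn (fun s => insert v s) ?_ ?_
  · intro s hs
    obtain ⟨σ, hσ, rfl⟩ := Finset.mem_map.1 hs
    have hc : (insert v σ.1).card = k + 2 := by
      rw [Finset.card_insert_of_notMem (hv σ hσ), σ.2]
    refine Finset.mem_map.2 ⟨⟨insert v σ.1, hc⟩, Finset.mem_filter.2 ⟨Finset.mem_univ _, ?_,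
      Finset.mem_insert_self _ _⟩, rfl⟩
    rw [← extendZero_coe (sd β)]
    change extendZero (sd β) (insert v σ.1) ≠ 0
    rw [← add_sd_contractAt_of_notMem β (hv σ hσ)]
    exact (Finset.mem_filter.1 hσ).2
  · intro s hs t ht hst
    obtain ⟨σ, hσ, rfl⟩ := Finset.mem_map.1 hs
    obtain ⟨ρ, hρ, rfl⟩ := Finset.mem_map.1 ht
    have := congrArg (fun u => u.erase v) hst
    simpa [Finset.erase_insert (hv σ hσ), Finset.erase_insert (hv ρ hρ)] using this

lemma qnorm_le {n k : ℕ} (β : SFace n (k + 1) → ZMod 2) (α : SFace n k → ZMod 2) :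
    qnorm β ≤ cnorm (β + sd α) :=
  Nat.sInf_le ⟨α, rfl⟩

lemma exists_cnorm_eq_qnorm {n k : ℕ} (β : SFace n (k + 1) → ZMod 2) :
    ∃ α : SFace n k → ZMod 2, qnorm β = cnorm (β + sd α) :=
  Nat.sInf_mem (s := {m | ∃ α : SFace n k → ZMod 2, m = cnorm (β + sd α)}) ⟨_, 0, rfl⟩

/-- Coboundary expansion of the complete complex. -/
lemma mul_qnorm_le {n k : ℕ} (β : SFace n (k + 1) → ZMod 2) :
    n * qnorm β ≤ (k + 2) * cnorm (sd β) := by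
  calc n * qnorm β = ∑ _v : Fin n, qnorm β := by simp
    _ ≤ ∑ v : Fin n,
        (Finset.univ.filter fun τ : SFace n (k + 2) => sd β τ ≠ 0 ∧ v ∈ τ.1).card :=
      Finset.sum_le_sum fun v _ =>
        (qnorm_le β _).trans (cnorm_add_sd_contractAt_le v β)
    _ = ∑ v : Fin n, ∑ τ ∈ Finset.univ.filter fun τ : SFace n (k + 2) => sd β τ ≠ 0,
        if v ∈ τ.1 then 1 else 0 := by
      refine Finset.sum_congr rfl fun v _ => ?_
      rw [← Finset.filter_filter, Finset.card_filter]
    _ = ∑ τ ∈ Finset.univ.filter fun τ : SFace n (k + 2) => sd β τ ≠ 0, (k + 2) := by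
      rw [Finset.sum_comm]
      refine Finset.sum_congr rfl fun τ _ => ?_
      rw [← Finset.card_filter]
      simp [τ.2]
    _ = (k + 2) * cnorm (sd β) := by
      rw [Finset.sum_const, smul_eq_mul, mul_comm]
      rfl

/-- Generating function of the size of a `p`-random subset inside a fixed set `T`. -/
lemma sum_bernoulli_mul_pow {X : Type*} [Fintype X] (T : Finset X) (p a : ℝ) :
    ∑ Y : Finset X, p ^ Y.card * (1 - p) ^ (Fintype.card X - Y.card) *
      a ^ (Y.filter fun x => x ∈ T).card = (p * a + (1 - p)) ^ T.card := by
  have h := Finset.prod_add (fun x => p * if x ∈ T then a else 1) (fun _ : X => 1 - p)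
    Finset.univ
  rw [Finset.powerset_univ] at h
  calc _ = ∏ x : X, ((p * if x ∈ T then a else 1) + (1 - p)) := by
        rw [h]
        refine Finset.sum_congr rfl fun Y _ => ?_
        rw [Finset.prod_mul_distrib, Finset.prod_const, Finset.prod_const,
          Finset.card_sdiff_of_subset (Finset.subset_univ Y), Finset.card_univ, Finset.prod_ite]
        simp only [Finset.prod_const]
        ring
    _ = ∏ x : X, if x ∈ T then p * a + (1 - p) else 1 := by
        refine Finset.prod_congr rfl fun x _ => ?_
        split_ifs <;> ring
    _ = _ := by
        rw [Finset.prod_ite]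
        simp

lemma exp_neg_le_quadratic {x : ℝ} (hx : 0 ≤ x) : Real.exp (-x) ≤ 1 - x + x ^ 2 / 2 := by
  have h := Real.quadratic_le_exp_of_nonneg hx
  have hpos : 0 < 1 - x + x ^ 2 / 2 := by nlinarith [sq_nonneg (x - 1)]
  rw [Real.exp_neg]
  refine inv_le_of_inv_le₀ hpos (le_trans ?_ h)
  rw [inv_le_iff_one_le_mul₀ hpos]
  nlinarith [sq_nonneg (x ^ 2)]

/-- Chernoff-type bound for the lower tail of a binomial variable. -/
lemma sum_bernoulli_mul_exp_le {X : Type*} [Fintype X] (T : Finset X) {p ε θ : ℝ}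
    (hp0 : 0 ≤ p) (hp1 : p ≤ 1) (hε0 : 0 ≤ ε) (hε1 : ε ≤ 1) (hθ : θ ≤ T.card) :
    ∑ Y : Finset X, p ^ Y.card * (1 - p) ^ (Fintype.card X - Y.card) *
      Real.exp (ε * ((1 - ε) * p * θ - (Y.filter fun x => x ∈ T).card)) ≤
      Real.exp (-(p * θ * ε ^ 2 / 2)) := by
  have hexp : ∀ Y : Finset X,
      Real.exp (ε * ((1 - ε) * p * θ - (Y.filter fun x => x ∈ T).card)) =
        Real.exp (-ε) ^ (Y.filter fun x => x ∈ T).card * Real.exp (ε * (1 - ε) * p * θ) := by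
    intro Y
    rw [← Real.exp_nat_mul, ← Real.exp_add]
    congr 1
    ring
  simp only [hexp, ← mul_assoc]
  rw [← Finset.sum_mul, sum_bernoulli_mul_pow]
  have hq := exp_neg_le_quadratic hε0
  have hbase : p * Real.exp (-ε) + (1 - p) ≤ Real.exp (-(p * (ε - ε ^ 2 / 2))) := by
    refine le_trans ?_ (Real.add_one_le_exp _)
    nlinarith
  have hbase0 : 0 ≤ p * Real.exp (-ε) + (1 - p) := by
    have := Real.exp_pos (-ε)
    have := mul_nonneg hp0 this.le
    linarith
  calc _ ≤ Real.exp (-(p * (ε - ε ^ 2 / 2))) ^ T.card * Real.exp (ε * (1 - ε) * p * θ) := by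
        gcongr
    _ = Real.exp (-(T.card * (p * (ε - ε ^ 2 / 2))) + ε * (1 - ε) * p * θ) := by
        rw [← Real.exp_nat_mul, ← Real.exp_add]
        congr 1
        ring
    _ ≤ _ := by
        apply Real.exp_le_exp.2
        have : 0 ≤ p * (ε - ε ^ 2 / 2) := mul_nonneg hp0 (by nlinarith)
        nlinarith [mul_le_mul_of_nonneg_right hθ this]

lemma sum_pow_cnorm {X : Type} [Fintype X] [DecidableEq X] (x : ℝ) :
    ∑ β : X → ZMod 2, x ^ cnorm β = (1 + x) ^ Fintype.card X := by
  have h : ∀ β : X → ZMod 2, x ^ cnorm β = ∏ i, if β i ≠ 0 then x else 1 := by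
    intro β
    rw [Finset.prod_ite]
    simp [cnorm]
  simp only [h]
  rw [← Fintype.prod_sum (fun (_ : X) (b : ZMod 2) => if b ≠ 0 then x else 1)]
  have h2 : ∑ b : ZMod 2, (if b ≠ 0 then x else 1) = 1 + x := by
    rw [show (Finset.univ : Finset (ZMod 2)) = {0, 1} from rfl]
    simp
  rw [h2, Finset.prod_const, Finset.card_univ]

lemma card_sFace_le (n m : ℕ) : Fintype.card (SFace n m) ≤ n ^ m := by
  rw [Fintype.card_finset_len, Fintype.card_fin]
  exact Nat.choose_le_pow n m

lemma cnorm_pos {X : Type} [Fintype X] {β : X → ZMod 2} (hβ : β ≠ 0) : 0 < cnorm β := by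
  obtain ⟨x, hx⟩ := Function.ne_iff.1 hβ
  exact Finset.card_pos.2 ⟨x, Finset.mem_filter.2 ⟨Finset.mem_univ _, hx⟩⟩

/-- A failure of expansion is witnessed by a nonzero cochain of minimal norm in its class. -/
lemma exists_minimal_witness {n k : ℕ} {β : SFace n (k + 1) → ZMod 2} (hβ : ¬ IsCob β) :
    ∃ γ : SFace n (k + 1) → ZMod 2, γ ≠ 0 ∧ sd γ = sd β ∧ cnorm γ = qnorm β ∧
      n * cnorm γ ≤ (k + 2) * cnorm (sd γ) := by
  obtain ⟨α, hα⟩ := exists_cnorm_eq_qnorm β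
  have hsd : sd (β + sd α) = sd β := by rw [sd_add, sd_sd, add_zero]
  refine ⟨β + sd α, fun h => hβ ⟨α, ?_⟩, hsd, hα.symm, ?_⟩
  · funext σ
    exact (CharTwo.add_eq_zero.1 (congrFun h σ)).symm
  · rw [hsd, ← hα]
    exact mul_qnorm_le β

lemma one_sub_le_prob_expansion {n k : ℕ} {p ε : ℝ} (hp0 : 0 ≤ p) (hp1 : p ≤ 1)
    (hε0 : 0 ≤ ε) (hε1 : ε ≤ 1) :
    2 - (1 + Real.exp (-(p * n * ε ^ 2 / (2 * (k + 2))))) ^ Fintype.card (SFace n (k + 1)) ≤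
      ∑ Y : Finset (SFace n (k + 2)),
        if ∀ β : SFace n (k + 1) → ZMod 2, ¬ IsCob β →
            ((Y.filter fun τ => sd β τ ≠ 0).card : ℝ) ≥
              (1 - ε) * p * ((n : ℝ) / ((k : ℝ) + 2)) * (qnorm β : ℝ)
          then p ^ Y.card * (1 - p) ^ (Fintype.card (SFace n (k + 2)) - Y.card) else 0 := by
  set x := Real.exp (-(p * n * ε ^ 2 / (2 * (k + 2)))) with hx
  set w : Finset (SFace n (k + 2)) → ℝ := fun Y =>
    p ^ Y.card * (1 - p) ^ (Fintype.card (SFace n (k + 2)) - Y.card)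
  have hw0 : ∀ Y, 0 ≤ w Y := fun Y =>
    mul_nonneg (pow_nonneg hp0 _) (pow_nonneg (sub_nonneg.2 hp1) _)
  have hw1 : ∑ Y, w Y = 1 := by
    have h := sum_bernoulli_mul_pow (∅ : Finset (SFace n (k + 2))) p 1
    simpa only [one_pow, mul_one, Finset.card_empty, pow_zero] using h
  let B : Finset (SFace n (k + 1) → ZMod 2) :=
    Finset.univ.filter fun γ => γ ≠ 0 ∧ n * cnorm γ ≤ (k + 2) * cnorm (sd γ)
  let f : (SFace n (k + 1) → ZMod 2) → Finset (SFace n (k + 2)) → ℝ := fun γ Y =>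
    Real.exp (ε * ((1 - ε) * p * ((n : ℝ) / (k + 2) * cnorm γ) -
      (Y.filter fun τ => sd γ τ ≠ 0).card))
  have hpoint : ∀ Y, w Y * (1 - ∑ γ ∈ B, f γ Y) ≤
      if ∀ β : SFace n (k + 1) → ZMod 2, ¬ IsCob β →
            ((Y.filter fun τ => sd β τ ≠ 0).card : ℝ) ≥
              (1 - ε) * p * ((n : ℝ) / ((k : ℝ) + 2)) * (qnorm β : ℝ)
          then w Y else 0 := by
    intro Y
    have hf : ∀ γ ∈ B, 0 ≤ f γ Y := fun γ _ => (Real.exp_pos _).le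
    split_ifs with hY
    · exact mul_le_of_le_one_right (hw0 Y) (by linarith [Finset.sum_nonneg hf])
    · refine mul_nonpos_of_nonneg_of_nonpos (hw0 Y) (sub_nonpos.2 ?_)
      push Not at hY
      obtain ⟨β, hβ, hlt⟩ := hY
      obtain ⟨γ, hγ0, hsd, hnorm, hexp⟩ := exists_minimal_witness hβ
      refine le_trans ?_ (Finset.single_le_sum hf
        (Finset.mem_filter.2 ⟨Finset.mem_univ γ, hγ0, hexp⟩))
      refine Real.one_le_exp (mul_nonneg hε0 (sub_nonneg.2 ?_))
      rw [hsd, hnorm]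
      refine le_trans hlt.le (le_of_eq ?_)
      ring
  have hk : (0 : ℝ) < k + 2 := by positivity
  have hbound : ∀ γ ∈ B, ∑ Y, w Y * f γ Y ≤ x ^ cnorm γ := by
    intro γ hγ
    have hexp : n * cnorm γ ≤ (k + 2) * cnorm (sd γ) := (Finset.mem_filter.1 hγ).2.2
    have hθ : (n : ℝ) / (k + 2) * cnorm γ ≤ (Finset.univ.filter fun τ => sd γ τ ≠ 0).card := by
      rw [div_mul_eq_mul_div, div_le_iff₀ hk, mul_comm _ ((k : ℝ) + 2)]
      exact_mod_cast hexp
    have h := sum_bernoulli_mul_exp_le (Finset.univ.filter fun τ => sd γ τ ≠ 0)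
      hp0 hp1 hε0 hε1 hθ
    simp only [Finset.mem_filter, Finset.mem_univ, true_and] at h
    refine h.trans (le_of_eq ?_)
    rw [hx, ← Real.exp_nat_mul]
    congr 1
    field_simp
  have hB : ∑ γ ∈ B, x ^ cnorm γ ≤ (1 + x) ^ Fintype.card (SFace n (k + 1)) - 1 := by
    have hsub : B ⊆ Finset.univ.erase 0 := fun γ hγ =>
      Finset.mem_erase.2 ⟨(Finset.mem_filter.1 hγ).2.1, Finset.mem_univ _⟩
    have hnn : ∀ γ ∈ Finset.univ.erase (0 : SFace n (k + 1) → ZMod 2), γ ∉ B →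
        0 ≤ x ^ cnorm γ := fun γ _ _ => pow_nonneg (Real.exp_pos _).le _
    refine (Finset.sum_le_sum_of_subset_of_nonneg hsub hnn).trans (le_of_eq ?_)
    have h0 := Finset.sum_erase_add Finset.univ
      (fun γ : SFace n (k + 1) → ZMod 2 => x ^ cnorm γ) (Finset.mem_univ 0)
    rw [sum_pow_cnorm] at h0
    rw [← h0]
    simp [cnorm]
  calc _ ≤ 1 - ∑ γ ∈ B, ∑ Y, w Y * f γ Y := by
        linarith [Finset.sum_le_sum hbound]
    _ = ∑ Y, w Y * (1 - ∑ γ ∈ B, f γ Y) := by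
        simp only [mul_sub, mul_one, Finset.sum_sub_distrib, hw1, Finset.mul_sum]
        rw [Finset.sum_comm]
    _ ≤ _ := Finset.sum_le_sum fun Y _ => hpoint Y

/-- expansion of the Linial–Meshulam random complex
`Y ∈ Y_k(n, p(n))`. Fix `k ≥ 1`, `0 < ε < 1`, `ω → ∞` and
`p(n) ≥ (2(k+1)(k+2)·log n + ω(n))/(ε²n)`. Then the probability (a weighted
sum over all sets `Y` of `(k+1)`-faces, each face kept independently with
probability `p(n)`) of the event that every non-coboundary `k`-cochain `β`
satisfies `‖dβ‖_Y ≥ (1-ε)·p(n)·(n/(k+2))·‖[β]‖` — i.e. that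
`h^k(Y) ≥ (1-ε)·p(n)·n/(k+2)` — tends to `1` as `n → ∞`. -/
theorem linial_meshulam_expansion (k : ℕ) (hk : 1 ≤ k) (ε : ℝ) (hε0 : 0 < ε) (hε1 : ε < 1)
    (ω : ℕ → ℝ) (hω : Filter.Tendsto ω Filter.atTop Filter.atTop)
    (p : ℕ → ℝ) (hp0 : ∀ n, 0 ≤ p n) (hp1 : ∀ n, p n ≤ 1)
    (hp : ∀ n : ℕ, p n ≥ (2 * ((k : ℝ) + 1) * ((k : ℝ) + 2) * Real.log n + ω n) /
      (ε ^ 2 * (n : ℝ))) :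
    Filter.Tendsto
      (fun n : ℕ => ∑ Y : Finset (SFace n (k + 2)),
        if ∀ β : SFace n (k + 1) → ZMod 2, ¬ IsCob β →
            ((Y.filter fun τ => sd β τ ≠ 0).card : ℝ) ≥
              (1 - ε) * p n * ((n : ℝ) / ((k : ℝ) + 2)) * (qnorm β : ℝ)
          then p n ^ Y.card * (1 - p n) ^ (Fintype.card (SFace n (k + 2)) - Y.card) else 0)
      Filter.atTop (nhds 1) := by
  have hk2 : (0 : ℝ) < 2 * (k + 2) := by positivity
  have hlim : Filter.Tendsto (fun n => 2 - Real.exp (Real.exp (-(ω n / (2 * (k + 2))))))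
      Filter.atTop (nhds 1) := by
    have h1 : Filter.Tendsto (fun n => Real.exp (-(ω n / (2 * (k + 2))))) Filter.atTop
        (nhds 0) :=
      Real.tendsto_exp_neg_atTop_nhds_zero.comp (hω.atTop_div_const hk2)
    have h2 := (Real.continuous_exp.tendsto 0).comp h1
    rw [Real.exp_zero] at h2
    have h3 := h2.const_sub 2
    norm_num at h3
    exact h3
  refine tendsto_of_tendsto_of_tendsto_of_le_of_le' hlim tendsto_const_nhds ?_ ?_
  · filter_upwards [Filter.eventually_ge_atTop 1] with n hn
    refine le_trans (sub_le_sub_left ?_ 2)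
      (one_sub_le_prob_expansion (n := n) (k := k) (hp0 n) (hp1 n) hε0.le hε1.le)
    set x := Real.exp (-(p n * n * ε ^ 2 / (2 * (k + 2)))) with hx
    have hx0 : 0 < x := Real.exp_pos _
    have hn0 : (0 : ℝ) < n := by exact_mod_cast hn
    have hmul : (n : ℝ) ^ (k + 1) * x ≤ Real.exp (-(ω n / (2 * (k + 2)))) := by
      have hpn := hp n
      rw [ge_iff_le, div_le_iff₀ (by positivity)] at hpn
      rw [← Real.exp_log (pow_pos hn0 (k + 1)), hx, ← Real.exp_add, Real.log_pow]
      apply Real.exp_le_exp.2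
      have h : (((k + 1 : ℕ) : ℝ) * Real.log n + ω n / (2 * (k + 2))) ≤
          p n * n * ε ^ 2 / (2 * (k + 2)) := by
        rw [le_div_iff₀ hk2, add_mul, div_mul_cancel₀ _ hk2.ne']
        push_cast
        linarith
      linarith
    calc (1 + x) ^ Fintype.card (SFace n (k + 1)) ≤ (1 + x) ^ (n ^ (k + 1)) :=
          pow_le_pow_right₀ (by linarith) (card_sFace_le n (k + 1))
      _ ≤ Real.exp x ^ (n ^ (k + 1)) := by
          gcongr
          linarith [Real.add_one_le_exp x]
      _ = Real.exp ((n : ℝ) ^ (k + 1) * x) := by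
          rw [← Real.exp_nat_mul]
          push_cast
          rfl
      _ ≤ _ := Real.exp_le_exp.2 hmul
  · refine Filter.Eventually.of_forall fun n => ?_
    have hw1 := sum_bernoulli_mul_pow (∅ : Finset (SFace n (k + 2))) (p n) 1
    simp only [one_pow, mul_one, Finset.card_empty, pow_zero] at hw1
    refine (Finset.sum_le_sum fun Y _ => ?_).trans_eq hw1
    split_ifs
    · exact le_rfl
    · exact mul_nonneg (pow_nonneg (hp0 n) _) (pow_nonneg (sub_nonneg.2 (hp1 n)) _)
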